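/- Fix lambda > 0 and a natural number Q >= 1. The function T -> S(lambda * T, Q) is twice differentiable at every T > 0 and its second derivative equals lambda^2 * p(lambda * T, Q - 1). -/

import Mathlib

open scoped BigOperators

/-- Poisson probability mass function with mean `μ` at `r`. -/
noncomputable def poissonPMF (μ : ℝ) (r : ℕ) : ℝ :=
  Real.exp (-μ) * μ ^ r / (Nat.factorial r)

/-- Poisson tail probability `P(D ≥ k)` for a natural-number threshold `k`. -/
noncomputable def Ptail (μ : ℝ) (k : ℕ) : ℝ :=
  ∑' r : ℕ, if k ≤ r then poissonPMF μ r else 0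

/-- Expected shortage `E[(D - Q)^+]` for a natural-number capacity `Q`. -/
noncomputable def shortage (μ : ℝ) (Q : ℕ) : ℝ :=
  ∑' r : ℕ, if Q ≤ r then ((r : ℝ) - (Q : ℝ)) * poissonPMF μ r else 0

lemma hasSum_poissonPMF (μ : ℝ) : HasSum (poissonPMF μ) 1 := by
  have h := (NormedSpace.expSeries_div_hasSum_exp μ).mul_left (Real.exp (-μ))
  rw [← Real.exp_eq_exp_ℝ, ← Real.exp_add, neg_add_cancel, Real.exp_zero] at h
  simp only [← mul_div_assoc] at h
  exact h

lemma succ_mul_poissonPMF_succ (μ : ℝ) (r : ℕ) :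
    ((r + 1 : ℕ) : ℝ) * poissonPMF μ (r + 1) = μ * poissonPMF μ r := by
  have h₁ : ((r + 1 : ℕ) : ℝ) ≠ 0 := by positivity
  have h₂ : (r.factorial : ℝ) ≠ 0 := by positivity
  rw [poissonPMF, poissonPMF, Nat.factorial_succ, Nat.cast_mul]
  field_simp
  ring

lemma hasSum_mul_poissonPMF (μ : ℝ) : HasSum (fun r : ℕ => (r : ℝ) * poissonPMF μ r) μ := by
  rw [← hasSum_nat_add_iff' 1]
  simpa [-Nat.cast_add, succ_mul_poissonPMF_succ] using (hasSum_poissonPMF μ).mul_left μ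

lemma hasDerivAt_poissonPMF_zero (μ : ℝ) :
    HasDerivAt (fun x => poissonPMF x 0) (-poissonPMF μ 0) μ := by
  simpa [poissonPMF] using (hasDerivAt_neg μ).exp

lemma hasDerivAt_poissonPMF_succ (μ : ℝ) (r : ℕ) :
    HasDerivAt (fun x => poissonPMF x (r + 1)) (poissonPMF μ r - poissonPMF μ (r + 1)) μ := by
  have h := (((hasDerivAt_neg μ).exp.mul (hasDerivAt_pow (r + 1) μ)).div_const
    ((r + 1).factorial : ℝ))
  refine h.congr_deriv ?_
  have h₁ : ((r + 1 : ℕ) : ℝ) ≠ 0 := by positivity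
  have h₂ : (r.factorial : ℝ) ≠ 0 := by positivity
  rw [poissonPMF, poissonPMF, Nat.factorial_succ, Nat.cast_mul, Nat.add_sub_cancel]
  field_simp
  ring

lemma summable_ite_poissonPMF (μ : ℝ) (k : ℕ) :
    Summable (fun r : ℕ => if k ≤ r then poissonPMF μ r else 0) :=
  ((hasSum_poissonPMF μ).summable.indicator {r | k ≤ r}).congr fun r => by
    simp [Set.indicator_apply]

lemma summable_ite_sub_mul_poissonPMF (μ : ℝ) (Q : ℕ) :
    Summable (fun r : ℕ => if Q ≤ r then ((r : ℝ) - (Q : ℝ)) * poissonPMF μ r else 0) := by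
  have h := (hasSum_mul_poissonPMF μ).summable.sub
    ((hasSum_poissonPMF μ).summable.mul_left (Q : ℝ))
  simp only [← sub_mul] at h
  exact (h.indicator {r | Q ≤ r}).congr fun r => by simp [Set.indicator_apply]

lemma Ptail_zero (μ : ℝ) : Ptail μ 0 = 1 := by
  simpa [Ptail] using (hasSum_poissonPMF μ).tsum_eq

lemma Ptail_succ (μ : ℝ) (k : ℕ) : Ptail μ (k + 1) = Ptail μ k - poissonPMF μ k := by
  have h := (summable_ite_poissonPMF μ k).hasSum.sub (hasSum_ite_eq k (poissonPMF μ k))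
  refine (tsum_congr fun r => ?_).trans h.tsum_eq
  rcases lt_trichotomy r k with hr | rfl | hr
  · simp [show ¬ k + 1 ≤ r by omega, show ¬ k ≤ r by omega, hr.ne]
  · simp
  · simp [show k + 1 ≤ r by omega, hr.le, hr.ne']

lemma shortage_zero (μ : ℝ) : shortage μ 0 = μ := by
  simpa [shortage] using (hasSum_mul_poissonPMF μ).tsum_eq

lemma shortage_succ (μ : ℝ) (Q : ℕ) : shortage μ (Q + 1) = shortage μ Q - Ptail μ (Q + 1) := by
  have h := (summable_ite_sub_mul_poissonPMF μ Q).hasSum.sub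
    (summable_ite_poissonPMF μ (Q + 1)).hasSum
  refine (tsum_congr fun r => ?_).trans h.tsum_eq
  rcases lt_trichotomy r Q with hr | rfl | hr
  · simp [show ¬ Q + 1 ≤ r by omega, show ¬ Q ≤ r by omega]
  · simp
  · simp only [show Q + 1 ≤ r by omega, hr.le, if_true]
    push_cast
    ring

lemma hasDerivAt_Ptail_succ (μ : ℝ) (k : ℕ) :
    HasDerivAt (fun x => Ptail x (k + 1)) (poissonPMF μ k) μ := by
  induction k with
  | zero =>
    simp only [Ptail_succ, Ptail_zero]
    simpa using (hasDerivAt_poissonPMF_zero μ).const_sub 1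
  | succ k ih =>
    simp only [Ptail_succ _ (k + 1)]
    exact (ih.sub (hasDerivAt_poissonPMF_succ μ k)).congr_deriv (by ring)

lemma hasDerivAt_shortage (μ : ℝ) (Q : ℕ) :
    HasDerivAt (fun x => shortage x Q) (Ptail μ Q) μ := by
  induction Q with
  | zero =>
    simp only [shortage_zero, Ptail_zero]
    exact hasDerivAt_id' μ
  | succ Q ih =>
    simp only [shortage_succ]
    exact (ih.sub (hasDerivAt_Ptail_succ μ Q)).congr_deriv (Ptail_succ μ Q).symm

/-- the expected shortage is twice differentiable in the cycle
length, with second derivative `λ² · p(λT, Q - 1)`. -/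
theorem shortage_second_deriv (lam : ℝ) (hlam : 0 < lam) (Q : ℕ) (hQ : 1 ≤ Q)
    (T : ℝ) (hT : 0 < T) :
    DifferentiableAt ℝ (fun t => shortage (lam * t) Q) T ∧
    HasDerivAt (deriv (fun t => shortage (lam * t) Q))
      (lam ^ 2 * poissonPMF (lam * T) (Q - 1)) T := by
  have hlin : ∀ t : ℝ, HasDerivAt (fun t => lam * t) lam t := fun t => by
    simpa using (hasDerivAt_id' t).const_mul lam
  have hS : ∀ t : ℝ, HasDerivAt (fun t => shortage (lam * t) Q) (Ptail (lam * t) Q * lam) t :=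
    fun t => (hasDerivAt_shortage (lam * t) Q).comp t (hlin t)
  refine ⟨(hS T).differentiableAt, ?_⟩
  rw [funext fun t => (hS t).deriv]
  obtain ⟨k, rfl⟩ := Nat.exists_eq_add_of_le' hQ
  have hP : HasDerivAt (fun t => Ptail (lam * t) (k + 1)) (poissonPMF (lam * T) k * lam) T :=
    (hasDerivAt_Ptail_succ (lam * T) k).comp T (hlin T)
  refine (hP.mul_const lam).congr_deriv ?_
  rw [Nat.add_sub_cancel]
  ring
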